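/- In the hidden-variable game with loopholes closed, Scientist AB has a strategy (a rule determining, from the history λ_1, …, λ_{n−1}, the bets {q_n^{AB}(·,·|s,t) ∈ P(Ω²)}_{(s,t)∈Θ} and the setting pair (s_n,t_n) ∈ Θ, chosen so that liminf_n T_n(u)/n > 0 for every u ∈ Θ) such that for every sequence λ : ℕ≥1 → Λ of Nature's moves, at least one of the two capital processes diverges: either K_n^{AB} → ∞ as n → ∞, or limsup_{n→∞} W_n^{AB} = ∞. Here outcomes are (ω_n^{s_n}, ω_n^{t_n}) := (X_{s_n}(λ_n), X_{t_n}(λ_n)), τ_n := (X_1(λ_n), X_2(λ_n), X_3(λ_n), X_4(λ_n)), u_n := (s_n,t_n), and the capitals satisfy K_0^{AB} = W_0^{AB} = 1, K_n^{AB} = K_{n−1}^{AB} · q_n^{AB}(ω_n^{s_n}, ω_n^{t_n}|s_n,t_n) / p(ω_n^{s_n}, ω_n^{t_n}|s_n,t_n), and W_n^{AB} = W_{n−1}^{AB} · P̂_n(τ_n; u_n) / (Q̂_n(τ_n) · R̂_n(u_n)). -/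

import Mathlib

open Filter

/-- The two-point set `{+1, -1}` of measurement outcomes. -/
abbrev Sign := ({1, -1} : Finset ℤ)

/-- The four preassigned outcomes: an element of `Ω⁴`. -/
abbrev O4 := Sign × Sign × Sign × Sign

/-- The set of joint measurement settings `Θ = {1,2} × {3,4}`. -/
def ThetaF : Finset (ℕ × ℕ) := ({1, 2} : Finset ℕ) ×ˢ ({3, 4} : Finset ℕ)

noncomputable def mu : ℝ := (2 - Real.sqrt 2) / 8
noncomputable def nu : ℝ := (2 + Real.sqrt 2) / 8

/-- The CHSH table `p(a,b|s,t)`. -/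
noncomputable def chshP (a b : Sign) (s t : ℕ) : ℝ :=
  if s = 1 ∧ t = 4 then (if a = b then nu else mu) else (if a = b then mu else nu)

/-- The history `λ₁ ⋯ λ_m` of Nature's first `m` moves, as a list. -/
def hist {Λ : Type*} (lam : ℕ → Λ) (m : ℕ) : List Λ :=
  (List.range m).map fun i => lam (i + 1)

/-- Joint count `T_n(τ; u) = #{k ≤ n : τ_k = τ, u_k = u}`. -/
def Tj (τ : ℕ → O4) (u : ℕ → ℕ × ℕ) (n : ℕ) (a : O4) (v : ℕ × ℕ) : ℕ :=
  ((Finset.Icc 1 n).filter fun k => τ k = a ∧ u k = v).card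

/-- Marginal count `T_n(τ) = #{k ≤ n : τ_k = τ}`. -/
def Tt (τ : ℕ → O4) (n : ℕ) (a : O4) : ℕ :=
  ((Finset.Icc 1 n).filter fun k => τ k = a).card

/-- Marginal count `T_n(u) = #{k ≤ n : u_k = u}`. -/
def Tu (u : ℕ → ℕ × ℕ) (n : ℕ) (v : ℕ × ℕ) : ℕ :=
  ((Finset.Icc 1 n).filter fun k => u k = v).card

open scoped Nat

section Counting

variable {ι : Type*} [DecidableEq ι]

/-- The number of indices `1 ≤ k ≤ n` with `x k = a`. -/
def visitCount (x : ℕ → ι) (n : ℕ) (a : ι) : ℕ :=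
  ((Finset.Icc 1 n).filter fun k => x k = a).card

theorem visitCount_succ (x : ℕ → ι) (n : ℕ) (a : ι) :
    visitCount x (n + 1) a = visitCount x n a + if a = x (n + 1) then 1 else 0 := by
  unfold visitCount
  rw [show Finset.Icc 1 (n + 1) = insert (n + 1) (Finset.Icc 1 n) by ext; simp; omega,
    Finset.filter_insert]
  by_cases h : a = x (n + 1)
  · rw [if_pos h.symm, if_pos h, Finset.card_insert_of_notMem (by simp)]
  · rw [if_neg (Ne.symm h), if_neg h, add_zero]

theorem visitCount_pos (x : ℕ → ι) {k : ℕ} (hk : 1 ≤ k) : 0 < visitCount x k (x k) :=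
  Finset.card_pos.2 ⟨k, by simp [hk]⟩

theorem prod_factorial_visitCount (x : ℕ → ι) (s : Finset ι) (hx : ∀ k, 1 ≤ k → x k ∈ s)
    (n : ℕ) :
    ∏ a ∈ s, (visitCount x n a)! = ∏ k ∈ Finset.Icc 1 n, visitCount x k (x k) := by
  induction n with
  | zero => simp [visitCount]
  | succ n ih =>
    rw [Finset.prod_Icc_succ_top (by omega), ← ih,
      ← Finset.prod_erase_mul s _ (hx (n + 1) (by omega)),
      ← Finset.prod_erase_mul s (fun a => (visitCount x n a)!) (hx (n + 1) (by omega)), mul_assoc]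
    congr 1
    · refine Finset.prod_congr rfl fun a ha => ?_
      rw [visitCount_succ, if_neg (Finset.ne_of_mem_erase ha), add_zero]
    · rw [visitCount_succ, if_pos rfl, Nat.factorial_succ, mul_comm]

theorem prod_pow_visitCount (x : ℕ → ι) (s : Finset ι) (hx : ∀ k, 1 ≤ k → x k ∈ s) (n : ℕ)
    (f : ι → ℝ) :
    ∏ a ∈ s, f a ^ visitCount x n a = ∏ k ∈ Finset.Icc 1 n, f (x k) := by
  rw [← Finset.prod_fiberwise_of_maps_to (t := s) (g := x)
    (fun k hk => hx k (Finset.mem_Icc.1 hk).1)]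
  refine Finset.prod_congr rfl fun a _ => ?_
  rw [Finset.prod_congr rfl (g := fun _ => f a)
    (fun k hk => by rw [(Finset.mem_filter.1 hk).2]), Finset.prod_const]
  rfl

end Counting

/-- A single term of the multinomial expansion is at most the whole sum. -/
theorem factorial_mul_prod_pow_le {κ : Type*} [DecidableEq κ] (s : Finset κ) (r : κ → ℝ)
    (hr : ∀ v ∈ s, 0 ≤ r v) {z : ℝ} (hz : ∑ v ∈ s, r v ≤ z) (t : κ → ℕ) :
    ((∑ v ∈ s, t v)! : ℝ) * ∏ v ∈ s, r v ^ t v ≤ z ^ (∑ v ∈ s, t v) * ∏ v ∈ s, ((t v)! : ℝ) := by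
  have hterm : (Nat.multinomial s t : ℝ) * ∏ v ∈ s, r v ^ t v ≤ z ^ (∑ v ∈ s, t v) := by
    refine le_trans ?_ (pow_le_pow_left₀ (Finset.sum_nonneg hr) hz _)
    rw [Finset.sum_pow_eq_sum_piAntidiag]
    set t' : κ → ℕ := fun v => if v ∈ s then t v else 0
    have heq : ∀ v ∈ s, t' v = t v := fun v hv => if_pos hv
    have hm : t' ∈ Finset.piAntidiag s (∑ v ∈ s, t v) := by
      rw [Finset.mem_piAntidiag]
      refine ⟨Finset.sum_congr rfl heq, fun v hv => ?_⟩
      by_contra hvs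
      exact hv (if_neg hvs)
    have h := Finset.single_le_sum
      (f := fun k : κ → ℕ => (Nat.multinomial s k : ℝ) * ∏ v ∈ s, r v ^ k v)
      (fun k _ => mul_nonneg (Nat.cast_nonneg _)
        (Finset.prod_nonneg fun v hv => pow_nonneg (hr v hv) _)) hm
    refine le_trans (le_of_eq ?_) h
    rw [Nat.multinomial_congr heq, Finset.prod_congr rfl fun v hv => by rw [← heq v hv]]
  rw [← Nat.multinomial_spec s t]
  push_cast
  calc _ = ((Nat.multinomial s t : ℝ) * ∏ v ∈ s, r v ^ t v) * ∏ v ∈ s, ((t v)! : ℝ) := by ring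
    _ ≤ _ := by gcongr

/-- Scientist AB's betting table. -/
noncomputable def betQ (v : ℕ × ℕ) (a b : Sign) : ℝ :=
  if v.1 = 1 ∧ v.2 = 4 then (if a = b then 2 / 5 else 1 / 10)
  else (if a = b then 1 / 10 else 2 / 5)

theorem betQ_pos (v : ℕ × ℕ) (a b : Sign) : 0 < betQ v a b := by
  unfold betQ; split_ifs <;> norm_num

theorem betQ_lt_one (v : ℕ × ℕ) (a b : Sign) : betQ v a b < 1 := by
  unfold betQ; split_ifs <;> norm_num

theorem sum_sign (f : Sign → ℝ) : ∑ a : Sign, f a = f ⟨1, by simp⟩ + f ⟨-1, by simp⟩ := by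
  have : (Finset.univ : Finset Sign) = {⟨1, by simp⟩, ⟨-1, by simp⟩} := by decide
  rw [this, Finset.sum_pair (by simp)]

theorem betQ_sum (v : ℕ × ℕ) : ∑ a : Sign, ∑ b : Sign, betQ v a b = 1 := by
  simp only [sum_sign, betQ]
  split_ifs <;> simp_all <;> norm_num

theorem mu_pos : 0 < mu := by
  have : Real.sqrt 2 < 2 := by rw [Real.sqrt_lt' (by norm_num)]; norm_num
  unfold mu; linarith

theorem nu_pos : 0 < nu := by unfold nu; positivity

theorem chshP_pos (a b : Sign) (s t : ℕ) : 0 < chshP a b s t := by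
  unfold chshP; split_ifs <;> first | exact mu_pos | exact nu_pos

/-- The coordinate of `a ∈ Ω⁴` selected by a setting `s ∈ {1, 2, 3, 4}`. -/
def outcome (a : O4) (s : ℕ) : Sign :=
  if s = 1 then a.1 else if s = 2 then a.2.1 else if s = 3 then a.2.2.1 else a.2.2.2

/-- The ratio of the CHSH probability to Scientist AB's bet, at preassigned outcomes `a`. -/
noncomputable def priceRatio (a : O4) (v : ℕ × ℕ) : ℝ :=
  chshP (outcome a v.1) (outcome a v.2) v.1 v.2 / betQ v (outcome a v.1) (outcome a v.2)

theorem priceRatio_pos (a : O4) (v : ℕ × ℕ) : 0 < priceRatio a v :=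
  div_pos (chshP_pos _ _ _ _) (betQ_pos _ _ _)

theorem ThetaF_eq : ThetaF = {(1, 3), (1, 4), (2, 3), (2, 4)} := by decide

/-- Bell's inequality, in the form that makes the betting table profitable. -/
theorem priceRatio_sum_le (a : O4) : ∑ v ∈ ThetaF, priceRatio a v ≤ 79 / 20 := by
  have h1 : Real.sqrt 2 < 1.42 := by rw [Real.sqrt_lt' (by norm_num)]; norm_num
  have h2 : 1.41 < Real.sqrt 2 := by rw [Real.lt_sqrt (by norm_num)]; norm_num
  have hsign : ∀ x : Sign, x = ⟨1, by simp⟩ ∨ x = ⟨-1, by simp⟩ := by decide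
  obtain ⟨a1, a2, a3, a4⟩ := a
  rw [ThetaF_eq]
  simp only [priceRatio, chshP, betQ, outcome]
  rcases hsign a1 with rfl | rfl <;> rcases hsign a2 with rfl | rfl <;>
    rcases hsign a3 with rfl | rfl <;> rcases hsign a4 with rfl | rfl <;>
    norm_num [mu, nu] <;> linarith

/-- The cyclic choice of settings. -/
def cyclicSetting (m : ℕ) : ℕ × ℕ :=
  if m % 4 = 0 then (1, 3) else if m % 4 = 1 then (1, 4) else if m % 4 = 2 then (2, 3) else (2, 4)

theorem cyclicSetting_mem (m : ℕ) : cyclicSetting m ∈ ThetaF := by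
  rw [ThetaF_eq]; unfold cyclicSetting; split_ifs <;> simp

theorem cyclicSetting_eq_iff (m j : ℕ) :
    cyclicSetting j = cyclicSetting m ↔ m % 4 = j % 4 := by
  unfold cyclicSetting
  split_ifs <;> simp <;> omega

theorem cyclicSetting_surj : ∀ v ∈ ThetaF, ∃ j < 4, v = cyclicSetting j := by decide

theorem visitCount_cyclic (u : ℕ → ℕ × ℕ) (hu : ∀ n, u (n + 1) = cyclicSetting n) (j : ℕ)
    (hj : j < 4) (n : ℕ) : visitCount u n (cyclicSetting j) = (n + 3 - j) / 4 := by
  induction n with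
  | zero => simp [visitCount]; omega
  | succ n ih =>
    rw [visitCount_succ, ih, hu]
    simp only [cyclicSetting_eq_iff]
    split_ifs <;> omega

theorem four_mul_visitCount_le (u : ℕ → ℕ × ℕ) (hu : ∀ n, u (n + 1) = cyclicSetting n) (n : ℕ) :
    4 * visitCount u (n + 1) (u (n + 1)) ≤ n + 4 := by
  obtain ⟨j, hj, h⟩ := cyclicSetting_surj _ (cyclicSetting_mem n)
  rw [hu, h, visitCount_cyclic u hu j hj]
  omega

theorem liminf_visitCount_pos (u : ℕ → ℕ × ℕ) (hu : ∀ n, u (n + 1) = cyclicSetting n)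
    (v : ℕ × ℕ) (hv : v ∈ ThetaF) :
    0 < liminf (fun n => (visitCount u n v : ℝ) / n) atTop := by
  obtain ⟨j, hj, rfl⟩ := cyclicSetting_surj v hv
  refine lt_of_lt_of_le (show (0 : ℝ) < 1 / 8 by norm_num) (le_liminf_of_le ?_ ?_)
  · refine IsBoundedUnder.isCoboundedUnder_ge ⟨1, ?_⟩
    rw [eventually_map]
    filter_upwards [eventually_ge_atTop 6] with n hn
    rw [div_le_one (by positivity), visitCount_cyclic u hu j hj]
    exact_mod_cast (by omega : (n + 3 - j) / 4 ≤ n)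
  · filter_upwards [eventually_ge_atTop 6] with n hn
    rw [le_div_iff₀ (by positivity), visitCount_cyclic u hu j hj]
    have h : (n : ℝ) ≤ 8 * ((n + 3 - j) / 4 : ℕ) := by
      exact_mod_cast (by omega : n ≤ 8 * ((n + 3 - j) / 4))
    linarith

theorem le_prod_div_visitCount_cyclic (u : ℕ → ℕ × ℕ) (hu : ∀ n, u (n + 1) = cyclicSetting n)
    (n : ℕ) : 4 ^ n * 6 / (((n : ℝ) + 1) * (n + 2) * (n + 3)) ≤
      ∏ k ∈ Finset.Icc 1 n, (k : ℝ) / visitCount u k (u k) := by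
  induction n with
  | zero => norm_num
  | succ n ih =>
    rw [Finset.prod_Icc_succ_top (by omega)]
    have hpos : (0 : ℝ) < visitCount u (n + 1) (u (n + 1)) := by
      exact_mod_cast visitCount_pos u (Nat.le_add_left 1 n)
    have hle : (4 : ℝ) * visitCount u (n + 1) (u (n + 1)) ≤ n + 4 := by
      exact_mod_cast four_mul_visitCount_le u hu n
    have hfac : 4 * ((n : ℝ) + 1) / (n + 4) ≤
        ((n + 1 : ℕ) : ℝ) / visitCount u (n + 1) (u (n + 1)) := by
      rw [div_le_div_iff₀ (by positivity) hpos]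
      push_cast
      nlinarith
    refine le_trans (le_of_eq ?_) (mul_le_mul ih hfac (by positivity) (le_trans (by positivity) ih))
    push_cast
    field_simp
    ring

/-- The outcome part of the product of the two capitals. -/
theorem prod_visitCount_mul_priceRatio_le (τ : ℕ → O4) (u : ℕ → ℕ × ℕ)
    (hu : ∀ k, 1 ≤ k → u k ∈ ThetaF) (n : ℕ) :
    ∏ k ∈ Finset.Icc 1 n, ((visitCount τ k (τ k) : ℝ) * priceRatio (τ k) (u k)) ≤
      (79 / 20) ^ n *
        ∏ k ∈ Finset.Icc 1 n, (visitCount (fun i => (τ i, u i)) k (τ k, u k) : ℝ) := by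
  set x : ℕ → O4 × (ℕ × ℕ) := fun i => (τ i, u i)
  have hx : ∀ k, 1 ≤ k → x k ∈ (Finset.univ : Finset O4) ×ˢ ThetaF := fun k hk =>
    Finset.mem_product.2 ⟨Finset.mem_univ _, hu k hk⟩
  have hsum : ∀ a, ∑ v ∈ ThetaF, visitCount x n (a, v) = visitCount τ n a := by
    intro a
    unfold visitCount
    rw [Finset.card_eq_sum_card_fiberwise (f := u) (t := ThetaF)
      (fun k hk => hu k (Finset.mem_Icc.1 (Finset.mem_filter.1 hk).1).1)]
    refine Finset.sum_congr rfl fun v _ => ?_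
    rw [Finset.filter_filter]
    simp [x, Prod.ext_iff]
  have htot : ∑ a : O4, visitCount τ n a = n := by
    have := Finset.card_eq_sum_card_fiberwise (f := τ) (s := Finset.Icc 1 n)
      (t := Finset.univ) (fun k _ => Finset.mem_univ _)
    simpa [visitCount] using this.symm
  have hτ := prod_factorial_visitCount τ Finset.univ (fun _ _ => Finset.mem_univ _) n
  have hρ := prod_pow_visitCount x _ hx n (fun y => priceRatio y.1 y.2)
  have hj := prod_factorial_visitCount x _ hx n
  rw [Finset.prod_mul_distrib, ← Nat.cast_prod, ← Nat.cast_prod, ← hτ, ← hj, ← hρ,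
    Finset.prod_product, Finset.prod_product]
  have hpow : (79 / 20 : ℝ) ^ n = (79 / 20 : ℝ) ^ ∑ a : O4, visitCount τ n a := by rw [htot]
  rw [hpow]
  push_cast
  rw [← Finset.prod_pow_eq_pow_sum, ← Finset.prod_mul_distrib, ← Finset.prod_mul_distrib]
  refine Finset.prod_le_prod (fun a _ => mul_nonneg (Nat.cast_nonneg _)
    (Finset.prod_nonneg fun v _ => pow_nonneg (priceRatio_pos _ _).le _)) fun a _ => ?_
  have := factorial_mul_prod_pow_le ThetaF (priceRatio a)
    (fun v _ => (priceRatio_pos a v).le) (priceRatio_sum_le a) (fun v => visitCount x n (a, v))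
  rwa [hsum] at this

theorem tendsto_pow_div_cubic {r : ℝ} (hr : 1 < r) :
    Tendsto (fun n : ℕ => r ^ n / (((n : ℝ) + 1) * (n + 2) * (n + 3))) atTop atTop := by
  have h0 := tendsto_pow_const_div_const_pow_of_one_lt 3 hr
  have h1 : Tendsto (fun n : ℕ => (n : ℝ) ^ 3 / r ^ n) atTop (nhdsWithin (0 : ℝ) (Set.Ioi 0)) :=
    tendsto_nhdsWithin_iff.2 ⟨h0, by
      filter_upwards [eventually_ge_atTop 1] with n hn
      have : (0 : ℝ) < n := by exact_mod_cast hn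
      rw [Set.mem_Ioi]
      positivity⟩
  have h2 := (h1.inv_tendsto_nhdsGT_zero).const_mul_atTop (show (0 : ℝ) < 1 / 24 by norm_num)
  refine tendsto_atTop_mono' _ ?_ h2
  filter_upwards [eventually_ge_atTop 1] with n hn
  have hn' : (1 : ℝ) ≤ n := by exact_mod_cast hn
  have hr0 : (0 : ℝ) < r ^ n := by positivity
  simp only [Pi.inv_apply, inv_div]
  rw [div_mul_div_comm, one_mul]
  refine div_le_div_of_nonneg_left hr0.le (by positivity) ?_
  calc ((n : ℝ) + 1) * (n + 2) * (n + 3) ≤ (n + n) * (n + 2 * n) * (n + 3 * n) := by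
        gcongr <;> linarith
    _ = 24 * (n : ℝ) ^ 3 := by ring

theorem eq_prod_Icc_of_step (F g : ℕ → ℝ) (h0 : F 0 = 1)
    (h : ∀ n, 1 ≤ n → F n = F (n - 1) * g n) (n : ℕ) : F n = ∏ k ∈ Finset.Icc 1 n, g k := by
  induction n with
  | zero => simpa
  | succ n ih => rw [Finset.prod_Icc_succ_top (by omega), h _ (by omega), Nat.add_sub_cancel, ih]

theorem tendsto_or_frequently_of_le_mul {K W c : ℕ → ℝ} (hc : Tendsto c atTop atTop)
    (hK : ∀ n, 0 < K n) (h : ∀ n, c n ≤ W n * K n) :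
    Tendsto K atTop atTop ∨ ∀ M : ℝ, ∃ᶠ n in atTop, M < W n := by
  refine or_iff_not_imp_right.2 fun hW => ?_
  push Not at hW
  obtain ⟨M, hM⟩ := hW
  have hM' : 0 < max M 1 := by positivity
  refine tendsto_atTop_mono' _ ?_ (hc.atTop_div_const hM')
  filter_upwards [hM] with n hn
  rw [div_le_iff₀ hM', mul_comm]
  exact (h n).trans (mul_le_mul_of_nonneg_right (hn.trans (le_max_left _ _)) (hK n).le)

theorem outcome_eq {Λ : Type*} (X : ℕ → Λ → Sign) (l : Λ) {v : ℕ × ℕ} (hv : v ∈ ThetaF) :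
    outcome (X 1 l, X 2 l, X 3 l, X 4 l) v.1 = X v.1 l ∧
      outcome (X 1 l, X 2 l, X 3 l, X 4 l) v.2 = X v.2 l := by
  rw [ThetaF_eq] at hv
  simp only [Finset.mem_insert, Finset.mem_singleton] at hv
  rcases hv with rfl | rfl | rfl | rfl <;> simp [outcome]

/-- **Scientist AB's winning strategy in the loopholes-closed game.**
Scientist AB has a strategy (bets and setting pair, as functions of the history
`λ₁,…,λₙ₋₁`, with every setting pair having positive lower density of being
chosen) such that for every sequence of Nature's moves `λ`, at least one of the
two capital processes diverges: either `Kₙ → ∞`, or `limsup Wₙ = ∞`. -/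
theorem loopholes_closed_game_winning_strategy
    {Λ : Type*} (X : ℕ → Λ → Sign)
    (hsurj : Function.Surjective fun l : Λ => (X 1 l, X 2 l, X 3 l, X 4 l)) :
    ∃ strat : List Λ → ((ℕ × ℕ) → Sign → Sign → ℝ) × (ℕ × ℕ),
      (∀ h, (strat h).2 ∈ ThetaF ∧
        ∀ st ∈ ThetaF, (∀ a b : Sign, (strat h).1 st a b ∈ Set.Ioo (0 : ℝ) 1) ∧
          ∑ a : Sign, ∑ b : Sign, (strat h).1 st a b = 1) ∧
      ∀ lam : ℕ → Λ, ∀ setting : ℕ → ℕ × ℕ, ∀ tau : ℕ → O4,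
        (∀ n, 1 ≤ n → setting n = (strat (hist lam (n - 1))).2) →
        (∀ n, tau n = (X 1 (lam n), X 2 (lam n), X 3 (lam n), X 4 (lam n))) →
        ((∀ v ∈ ThetaF, 0 < liminf (fun n => (Tu setting n v : ℝ) / n) atTop) ∧
          ∀ K W : ℕ → ℝ, K 0 = 1 → W 0 = 1 →
            (∀ n, 1 ≤ n → K n = K (n - 1) *
                (strat (hist lam (n - 1))).1 (setting n)
                  (X (setting n).1 (lam n)) (X (setting n).2 (lam n)) /
                chshP (X (setting n).1 (lam n)) (X (setting n).2 (lam n))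
                  (setting n).1 (setting n).2) →
            (∀ n, 1 ≤ n → W n = W (n - 1) *
                ((Tj tau setting n (tau n) (setting n) : ℝ) / n) /
                (((Tt tau n (tau n) : ℝ) / n) * ((Tu setting n (setting n) : ℝ) / n))) →
            (Tendsto K atTop atTop ∨ ∀ M : ℝ, ∃ᶠ n in atTop, M < W n)) := by
  refine ⟨fun h => (betQ, cyclicSetting h.length), fun h => ⟨cyclicSetting_mem _, fun v _ =>
    ⟨fun a b => ⟨betQ_pos v a b, betQ_lt_one v a b⟩, betQ_sum v⟩⟩, ?_⟩
  intro lam u τ hset hτ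
  have hu : ∀ n, u (n + 1) = cyclicSetting n := fun n => by
    rw [hset (n + 1) (by omega)]; simp [hist]
  have hmem : ∀ k, 1 ≤ k → u k ∈ ThetaF := fun k hk => by
    obtain ⟨m, rfl⟩ := Nat.exists_eq_add_of_le' hk
    rw [hu]; exact cyclicSetting_mem m
  refine ⟨fun v hv => liminf_visitCount_pos u hu v hv, ?_⟩
  intro K W hK0 hW0 hK hW
  have hKprod := eq_prod_Icc_of_step K (fun k => (priceRatio (τ k) (u k))⁻¹) hK0 (fun n hn => by
    rw [hK n hn, hτ n]
    obtain ⟨h1, h2⟩ := outcome_eq X (lam n) (hmem n hn)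
    simp only [priceRatio, h1, h2, inv_div, mul_div_assoc])
  set x : ℕ → O4 × (ℕ × ℕ) := fun i => (τ i, u i)
  have hWprod := eq_prod_Icc_of_step W (fun k => ((visitCount x k (τ k, u k) : ℝ) /
      visitCount τ k (τ k)) * ((k : ℝ) / visitCount u k (u k))) hW0 (fun n hn => by
    have hj : Tj τ u n (τ n) (u n) = visitCount x n (τ n, u n) := by
      simp [Tj, visitCount, x, Prod.ext_iff]
    have h1 : (0 : ℝ) < visitCount τ n (τ n) := by exact_mod_cast visitCount_pos τ hn
    have h2 : (0 : ℝ) < visitCount u n (u n) := by exact_mod_cast visitCount_pos u hn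
    have h3 : (0 : ℝ) < n := by exact_mod_cast hn
    rw [hW n hn, hj, show Tt τ n (τ n) = visitCount τ n (τ n) from rfl,
      show Tu u n (u n) = visitCount u n (u n) from rfl]
    field_simp)
  refine tendsto_or_frequently_of_le_mul
    ((tendsto_pow_div_cubic (show (1 : ℝ) < 80 / 79 by norm_num)).const_mul_atTop
      (show (0 : ℝ) < 6 by norm_num))
    (fun n => by
      rw [hKprod]; exact Finset.prod_pos fun k _ => inv_pos.2 (priceRatio_pos _ _))
    (fun n => ?_)
  have hden : 0 < ∏ k ∈ Finset.Icc 1 n, ((visitCount τ k (τ k) : ℝ) * priceRatio (τ k) (u k)) :=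
    Finset.prod_pos fun k hk => mul_pos
      (by exact_mod_cast visitCount_pos τ (Finset.mem_Icc.1 hk).1) (priceRatio_pos _ _)
  have hout := prod_visitCount_mul_priceRatio_le τ u hmem n
  have hout' : ((79 / 20 : ℝ) ^ n)⁻¹ ≤
      (∏ k ∈ Finset.Icc 1 n, (visitCount x k (τ k, u k) : ℝ)) /
        ∏ k ∈ Finset.Icc 1 n, ((visitCount τ k (τ k) : ℝ) * priceRatio (τ k) (u k)) := by
    rw [le_div_iff₀ hden, inv_mul_le_iff₀ (by positivity)]
    exact hout
  have hWK : W n * K n = ((∏ k ∈ Finset.Icc 1 n, (visitCount x k (τ k, u k) : ℝ)) /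
        ∏ k ∈ Finset.Icc 1 n, ((visitCount τ k (τ k) : ℝ) * priceRatio (τ k) (u k))) *
      ∏ k ∈ Finset.Icc 1 n, (k : ℝ) / visitCount u k (u k) := by
    rw [hWprod, hKprod, ← Finset.prod_mul_distrib, ← Finset.prod_div_distrib,
      ← Finset.prod_mul_distrib]
    refine Finset.prod_congr rfl fun k _ => ?_
    rw [div_mul_eq_div_div]
    ring
  rw [hWK]
  refine le_trans (le_of_eq ?_) (mul_le_mul hout' (le_prod_div_visitCount_cyclic u hu n)
    (by positivity) (le_trans (by positivity) hout'))
  rw [show (80 / 79 : ℝ) = 4 / (79 / 20) by norm_num, div_pow]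
  ring
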